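/- arXiv:2305.05437 — 2 statements merged into one kernel-verified Lean document; each statement's English description precedes it below -/
import Mathlib

section
/- Let u_ε be a classical solution of the regularized anisotropic problem with ε ∈ (0,ε₀], satisfying |u_ε| ≤ M on Q̄_T, and suppose F satisfies the monotonicity condition F(x,u,z) ≤ F(x,v,z) whenever u ≥ v. Then the time derivative satisfies |∂_t u_ε(t,x)| ≤ K for all (t,x) ∈ Q_T, where K is the constant defined in the context. -/
open Set Filter MeasureTheory Metric

noncomputable section

/-- The `i`-th partial derivative of a function on Euclidean space. -/
def pd {n : ℕ} (f : EuclideanSpace ℝ (Fin n) → ℝ) (i : Fin n)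
    (x : EuclideanSpace ℝ (Fin n)) : ℝ :=
  fderiv ℝ f x (EuclideanSpace.single i 1)

/-- The gradient vector of a function on Euclidean space. -/
def gradv {n : ℕ} (f : EuclideanSpace ℝ (Fin n) → ℝ)
    (x : EuclideanSpace ℝ (Fin n)) : EuclideanSpace ℝ (Fin n) :=
  (WithLp.equiv 2 (Fin n → ℝ)).symm (fun i => pd f i x)

/-- The exterior sphere condition for a domain. -/
def ExteriorSphereCond {n : ℕ} (Ω : Set (EuclideanSpace ℝ (Fin n))) : Prop :=
  ∀ y ∈ frontier Ω, ∃ z r, 0 < r ∧ closedBall z r ∩ closure Ω = {y}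

/-- `f` is of class `C^{1+γ}` on `s` (C¹ with γ-Hölder continuous derivative). -/
def C1HolderOn {n : ℕ} (γ : ℝ) (s : Set (EuclideanSpace ℝ (Fin n)))
    (f : EuclideanSpace ℝ (Fin n) → ℝ) : Prop :=
  ContDiffOn ℝ 1 f s ∧
    ∃ C : NNReal, HolderOnWith C γ.toNNReal (fun x => fderivWithin ℝ f s x) s

/-- Classical solution of the regularized anisotropic problem
`u_t = ∑ᵢ ((u_{xᵢ}² + ε)^{pᵢ(x)/2} u_{xᵢ})_{xᵢ} + F(x, u, ∇u)` in `Q_T = (0,T) × Ω`,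
with `u = ψ` on `∂Ω × (0,T)` and `u(0,·) = u₀` in `Ω`. -/
structure IsClassicalSolAniso {n : ℕ} (Ω : Set (EuclideanSpace ℝ (Fin n))) (T : ℝ)
    (p : Fin n → EuclideanSpace ℝ (Fin n) → ℝ)
    (F : EuclideanSpace ℝ (Fin n) → ℝ → EuclideanSpace ℝ (Fin n) → ℝ)
    (ψ u₀ : EuclideanSpace ℝ (Fin n) → ℝ) (ε : ℝ)
    (u : ℝ → EuclideanSpace ℝ (Fin n) → ℝ) : Prop where
  cont : ContinuousOn (fun q : ℝ × EuclideanSpace ℝ (Fin n) => u q.1 q.2)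
      (Icc 0 T ×ˢ closure Ω)
  diff_t : ∀ t ∈ Ioo 0 T, ∀ x ∈ Ω, DifferentiableAt ℝ (fun s => u s x) t
  smooth_x : ∀ t ∈ Ioo 0 T, ∀ x ∈ Ω, ContDiffAt ℝ 2 (u t) x
  cont_ut : ContinuousOn
      (fun q : ℝ × EuclideanSpace ℝ (Fin n) => deriv (fun s => u s q.2) q.1) (Ioo 0 T ×ˢ Ω)
  cont_ux : ∀ i, ContinuousOn
      (fun q : ℝ × EuclideanSpace ℝ (Fin n) => pd (u q.1) i q.2) (Ioo 0 T ×ˢ Ω)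
  cont_uxx : ∀ i j, ContinuousOn
      (fun q : ℝ × EuclideanSpace ℝ (Fin n) => pd (fun y => pd (u q.1) j y) i q.2)
      (Ioo 0 T ×ˢ Ω)
  eqn : ∀ t ∈ Ioo 0 T, ∀ x ∈ Ω,
      deriv (fun s => u s x) t =
        (∑ i, pd (fun y => ((pd (u t) i y) ^ 2 + ε) ^ (p i y / 2) * pd (u t) i y) i x)
          + F x (u t x) (gradv (u t) x)
  bdry : ∀ t ∈ Ioo 0 T, ∀ x ∈ frontier Ω, u t x = ψ x
  init : ∀ x ∈ closure Ω, u 0 x = u₀ x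

theorem parabolic_max_principle {E : Type*} [TopologicalSpace E] {Ω : Set E} (hΩo : IsOpen Ω)
    (hΩc : IsCompact (closure Ω)) {S : ℝ} {φ : ℝ → E → ℝ}
    (hc : ContinuousOn (fun q : ℝ × E => φ q.1 q.2) (Icc 0 S ×ˢ closure Ω))
    (h0 : ∀ x ∈ closure Ω, φ 0 x ≤ 0)
    (hb : ∀ t ∈ Ioc 0 S, ∀ x ∈ frontier Ω, φ t x ≤ 0)
    (hd : ∀ t ∈ Ioc 0 S, ∀ x ∈ Ω, 0 < φ t x → IsLocalMax (φ t) x →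
      ∃ d ≤ 0, HasDerivAt (fun s => φ s x) d t) :
    ∀ t ∈ Icc 0 S, ∀ x ∈ closure Ω, φ t x ≤ 0 := by
  intro t ht x hx
  by_contra! hpos
  have htpos : 0 < t := by
    refine lt_of_le_of_ne ht.1 ?_
    rintro rfl
    exact absurd (h0 x hx) (not_le.mpr hpos)
  obtain ⟨δ, hδ, hδt⟩ : ∃ δ : ℝ, 0 < δ ∧ 0 < φ t x - δ * t :=
    ⟨φ t x / (2 * t), by positivity, by field_simp; linarith⟩
  obtain ⟨⟨t₁, x₁⟩, ⟨ht₁, hx₁⟩, hmax⟩ := (isCompact_Icc.prod hΩc).exists_isMaxOn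
    ⟨(t, x), ht, hx⟩ (hc.sub ((continuous_const.mul continuous_fst).continuousOn :
      ContinuousOn (fun q : ℝ × E => δ * q.1) _))
  have hmax' : ∀ s ∈ Icc 0 S, ∀ y ∈ closure Ω, φ s y - δ * s ≤ φ t₁ x₁ - δ * t₁ :=
    fun s hs y hy => hmax (show (s, y) ∈ Icc 0 S ×ˢ closure Ω from ⟨hs, hy⟩)
  simp only at ht₁ hx₁
  have hφ : 0 < φ t₁ x₁ := by
    have := hmax' t ht x hx
    have := mul_nonneg hδ.le ht₁.1
    linarith
  have ht₁pos : 0 < t₁ := by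
    refine lt_of_le_of_ne ht₁.1 ?_
    rintro rfl
    exact absurd (h0 x₁ hx₁) (not_le.mpr hφ)
  have hx₁Ω : x₁ ∈ Ω := by
    by_contra hn
    exact absurd (hb t₁ ⟨ht₁pos, ht₁.2⟩ x₁ (by rw [hΩo.frontier_eq]; exact ⟨hx₁, hn⟩))
      (not_le.mpr hφ)
  obtain ⟨d, hd0, hdd⟩ := hd t₁ ⟨ht₁pos, ht₁.2⟩ x₁ hx₁Ω hφ (by
    filter_upwards [hΩo.mem_nhds hx₁Ω] with y hy
    linarith [hmax' t₁ ht₁ y (subset_closure hy)])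
  have hloc : IsLocalMaxOn (fun s => φ s x₁ - δ * s) (Icc 0 t₁) t₁ := by
    filter_upwards [self_mem_nhdsWithin] with s hs
    exact hmax' s ⟨hs.1, hs.2.trans ht₁.2⟩ x₁ hx₁
  have hder : HasDerivAt (fun s => φ s x₁ - δ * s) (d - δ * 1) t₁ :=
    hdd.sub ((hasDerivAt_id t₁).const_mul δ)
  have hle := hloc.hasFDerivWithinAt_nonpos hder.hasFDerivAt.hasFDerivWithinAt
    (y := 0 - t₁) (sub_mem_posTangentConeAt_of_segment_subset (by
      rw [segment_symm, segment_eq_Icc ht₁pos.le]))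
  simp at hle
  nlinarith

theorem IsLocalMax.deriv_deriv_nonpos {f : ℝ → ℝ} {a : ℝ} (h : IsLocalMax f a)
    (hc : ContinuousAt f a) : deriv (deriv f) a ≤ 0 := by
  by_contra! hpos
  have hmin := isLocalMin_of_deriv_deriv_pos hpos h.deriv_eq_zero hc
  have heq : f =ᶠ[nhds a] fun _ => f a := by
    filter_upwards [h, hmin] with y h₁ h₂ using le_antisymm h₁ h₂
  have := heq.deriv.deriv_eq
  simp at this
  exact hpos.ne' this

theorem hasDerivAt_pd {n : ℕ} {f : EuclideanSpace ℝ (Fin n) → ℝ} {x : EuclideanSpace ℝ (Fin n)} {s : ℝ}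
    (i : Fin n) (hf : DifferentiableAt ℝ f (x + s • EuclideanSpace.single i (1 : ℝ))) :
    HasDerivAt (fun s : ℝ => f (x + s • EuclideanSpace.single i (1 : ℝ)))
      (pd f i (x + s • EuclideanSpace.single i (1 : ℝ))) s := by
  have hl : HasDerivAt (fun s : ℝ => x + s • EuclideanSpace.single i (1 : ℝ))
      (EuclideanSpace.single i (1 : ℝ)) s := by
    simpa using ((hasDerivAt_id s).smul_const (EuclideanSpace.single i (1 : ℝ))).const_add x
  exact hf.hasFDerivAt.comp_hasDerivAt s hl

theorem hasDerivAt_pd_zero {n : ℕ} {f : EuclideanSpace ℝ (Fin n) → ℝ} {x : EuclideanSpace ℝ (Fin n)}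
    (i : Fin n) (hf : DifferentiableAt ℝ f x) :
    HasDerivAt (fun s : ℝ => f (x + s • EuclideanSpace.single i (1 : ℝ))) (pd f i x) 0 := by
  simpa using hasDerivAt_pd (s := 0) i (by simpa using hf)

theorem ContDiffAt.differentiableAt_pd {n : ℕ} {f : EuclideanSpace ℝ (Fin n) → ℝ}
    {x : EuclideanSpace ℝ (Fin n)} (hf : ContDiffAt ℝ 2 f x) (i : Fin n) :
    DifferentiableAt ℝ (pd f i) x :=
  ((hf.fderiv_right (m := 1) (by norm_num)).differentiableAt (by norm_num)).clm_apply
    (differentiableAt_const _)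

theorem IsLocalMax.pd_sub {n : ℕ} {f g : EuclideanSpace ℝ (Fin n) → ℝ} {x : EuclideanSpace ℝ (Fin n)}
    (h : IsLocalMax (fun y => f y - g y) x) (hf : ContDiffAt ℝ 2 f x) (hg : ContDiffAt ℝ 2 g x)
    (i : Fin n) :
    pd f i x = pd g i x ∧ pd (pd f i) i x ≤ pd (pd g i) i x := by
  have hf1 := hf.differentiableAt (by norm_num)
  have hg1 := hg.differentiableAt (by norm_num)
  have hline : Tendsto (fun s : ℝ => x + s • EuclideanSpace.single i (1 : ℝ)) (nhds 0)
      (nhds x) := by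
    have : Continuous fun s : ℝ => x + s • EuclideanSpace.single i (1 : ℝ) := by fun_prop
    simpa using this.tendsto 0
  have hmax : IsLocalMax (fun s : ℝ => f (x + s • EuclideanSpace.single i (1 : ℝ)) -
      g (x + s • EuclideanSpace.single i (1 : ℝ))) 0 := by
    filter_upwards [hline.eventually h] with s hs
    simpa using hs
  have hd := (hasDerivAt_pd_zero i hf1).sub (hasDerivAt_pd_zero i hg1)
  refine ⟨sub_eq_zero.mp (hmax.hasDerivAt_eq_zero hd), ?_⟩
  have hev : deriv (fun s : ℝ => f (x + s • EuclideanSpace.single i (1 : ℝ)) -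
      g (x + s • EuclideanSpace.single i (1 : ℝ))) =ᶠ[nhds 0]
      fun s => pd f i (x + s • EuclideanSpace.single i (1 : ℝ)) -
        pd g i (x + s • EuclideanSpace.single i (1 : ℝ)) := by
    filter_upwards [hline.eventually (hf.eventually (by simp)),
      hline.eventually (hg.eventually (by simp))] with s hs₁ hs₂
    exact ((hasDerivAt_pd i (hs₁.differentiableAt (by norm_num))).sub
      (hasDerivAt_pd i (hs₂.differentiableAt (by norm_num)))).deriv
  have h2 := hmax.deriv_deriv_nonpos hd.continuousAt
  rw [hev.deriv_eq, ((hasDerivAt_pd_zero i (hf.differentiableAt_pd i)).fun_sub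
    (hasDerivAt_pd_zero i (hg.differentiableAt_pd i))).deriv] at h2
  linarith

theorem gradv_congr {n : ℕ} {f g : EuclideanSpace ℝ (Fin n) → ℝ} {x : EuclideanSpace ℝ (Fin n)}
    (h : ∀ i, pd f i x = pd g i x) : gradv f x = gradv g x := by
  simp only [gradv, h]

theorem pd_flux {n : ℕ} {q r : EuclideanSpace ℝ (Fin n) → ℝ} {x : EuclideanSpace ℝ (Fin n)} {ε : ℝ}
    (hε : 0 < ε) (i : Fin n) (hq : DifferentiableAt ℝ q x) (hr : DifferentiableAt ℝ r x) :
    pd (fun y => (q y ^ 2 + ε) ^ (r y / 2) * q y) i x =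
      (q x ^ 2 + ε) ^ (r x / 2 - 1) * ((1 + r x) * q x ^ 2 + ε) * pd q i x +
        pd r i x / 2 * (q x ^ 2 + ε) ^ (r x / 2) * Real.log (q x ^ 2 + ε) * q x := by
  have hpos : 0 < q x ^ 2 + ε := by positivity
  have hdiff : DifferentiableAt ℝ (fun y => (q y ^ 2 + ε) ^ (r y / 2) * q y) x :=
    (((hq.fun_pow 2).add_const ε).rpow (by fun_prop) hpos.ne').mul hq
  have hq' := hasDerivAt_pd_zero i hq
  have hr' := hasDerivAt_pd_zero i hr
  have h1 := (((hq'.fun_pow 2).add_const ε).rpow (hr'.div_const 2) (by simpa using hpos)).mul hq'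
  have h2 := (hasDerivAt_pd_zero i hdiff).unique h1
  simp only [zero_smul, add_zero] at h2
  rw [h2, show (q x ^ 2 + ε) ^ (r x / 2) = (q x ^ 2 + ε) ^ (r x / 2 - 1) * (q x ^ 2 + ε) by
    rw [← Real.rpow_add_one hpos.ne']; ring_nf]
  push_cast
  ring

theorem IsLocalMax.sum_pd_flux_le {n : ℕ} {f g : EuclideanSpace ℝ (Fin n) → ℝ}
    {x : EuclideanSpace ℝ (Fin n)} {p : Fin n → EuclideanSpace ℝ (Fin n) → ℝ} {ε : ℝ}
    (h : IsLocalMax (fun y => f y - g y) x) (hf : ContDiffAt ℝ 2 f x) (hg : ContDiffAt ℝ 2 g x)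
    (hε : 0 < ε) (hp : ∀ i, DifferentiableAt ℝ (p i) x) (hp1 : ∀ i, -1 < p i x) :
    ∑ i, pd (fun y => ((pd f i y) ^ 2 + ε) ^ (p i y / 2) * pd f i y) i x ≤
      ∑ i, pd (fun y => ((pd g i y) ^ 2 + ε) ^ (p i y / 2) * pd g i y) i x := by
  refine Finset.sum_le_sum fun i _ => ?_
  obtain ⟨h1, h2⟩ := h.pd_sub hf hg i
  rw [pd_flux hε i (hf.differentiableAt_pd i) (hp i),
    pd_flux hε i (hg.differentiableAt_pd i) (hp i), h1]
  have : 0 < 1 + p i x := by linarith [hp1 i]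
  gcongr

theorem stmt2
    (n : ℕ) (hn : 0 < n)
    (Ω : Set (EuclideanSpace ℝ (Fin n)))
    (hΩo : IsOpen Ω) (hΩconn : IsConnected Ω)
    (hΩbd : Bornology.IsBounded Ω) (hΩsph : ExteriorSphereCond Ω)
    (T : ℝ) (hT : 0 < T)
    (γ : ℝ) (hγ : γ ∈ Ioo (0:ℝ) 1)
    (p : Fin n → EuclideanSpace ℝ (Fin n) → ℝ)
    (hp : ∀ i, C1HolderOn γ (closure Ω) (p i))
    (hp1 : ∀ i, ∀ x ∈ closure Ω, -1 < p i x)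
    (ε₀ : ℝ) (hε₀ : 0 < ε₀)
    (F : EuclideanSpace ℝ (Fin n) → ℝ → EuclideanSpace ℝ (Fin n) → ℝ)
    (hF : ContinuousOn
      (fun q : EuclideanSpace ℝ (Fin n) × ℝ × EuclideanSpace ℝ (Fin n) => F q.1 q.2.1 q.2.2)
      (closure Ω ×ˢ (univ : Set (ℝ × EuclideanSpace ℝ (Fin n)))))
    (hFmono : ∀ x ∈ closure Ω, ∀ v w : ℝ, ∀ z : EuclideanSpace ℝ (Fin n),
      w ≤ v → F x v z ≤ F x w z)
    (ψ u₀ : EuclideanSpace ℝ (Fin n) → ℝ)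
    (U : Set (EuclideanSpace ℝ (Fin n))) (hU : IsOpen U) (hUΩ : closure Ω ⊆ U)
    (hu₀ : ContDiffOn ℝ 2 u₀ U)
    (hu₀ψ : ∀ x ∈ frontier Ω, u₀ x = ψ x)
    (M : ℝ) (hM : 0 < M)
    (ε : ℝ) (hε : ε ∈ Ioc (0:ℝ) ε₀)
    (u : ℝ → EuclideanSpace ℝ (Fin n) → ℝ)
    (hu : IsClassicalSolAniso Ω T p F ψ u₀ ε u)
    (hub : ∀ t ∈ Icc 0 T, ∀ x ∈ closure Ω, |u t x| ≤ M)
    (A B K : ℝ)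
    (hA : IsLUB {a : ℝ | ∃ ε' ∈ Icc (0:ℝ) ε₀, ∃ x ∈ closure Ω,
      a = |∑ i, pd (fun y => ((pd u₀ i y) ^ 2 + ε') ^ (p i y / 2) * pd u₀ i y) i x|} A)
    (hB : IsLUB {a : ℝ | ∃ x ∈ closure Ω, ∃ v ∈ Icc (-M) M,
      a = |F x v (gradv u₀ x)|} B)
    (hK : K = A + B)
    :
    ∀ t ∈ Ioo 0 T, ∀ x ∈ Ω, |deriv (fun s => u s x) t| ≤ K := by
  have hε0 : 0 < ε := hε.1
  have hcpt : IsCompact (closure Ω) := hΩbd.isCompact_closure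
  have hpd : ∀ x ∈ Ω, ∀ i, DifferentiableAt ℝ (p i) x := fun x hx i =>
    ((hp i).1.contDiffAt (mem_of_superset (hΩo.mem_nhds hx) subset_closure)).differentiableAt
      (by norm_num)
  have hp1' : ∀ x ∈ Ω, ∀ i, -1 < p i x := fun x hx i => hp1 i x (subset_closure hx)
  have hu₀x : ∀ x ∈ Ω, ContDiffAt ℝ 2 u₀ x := fun x hx =>
    hu₀.contDiffAt (hU.mem_nhds (hUΩ (subset_closure hx)))
  have hAx : ∀ x ∈ Ω,
      |∑ i, pd (fun y => ((pd u₀ i y) ^ 2 + ε) ^ (p i y / 2) * pd u₀ i y) i x| ≤ A :=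
    fun x hx => hA.1 ⟨ε, ⟨hε0.le, hε.2⟩, x, subset_closure hx, rfl⟩
  have hBx : ∀ x ∈ Ω, |F x (u₀ x) (gradv u₀ x)| ≤ B := fun x hx => by
    have hcl := subset_closure hx
    refine hB.1 ⟨x, hcl, u₀ x, abs_le.mp ?_, rfl⟩
    rw [← hu.init x hcl]
    exact hub 0 ⟨le_rfl, hT.le⟩ x hcl
  have hK0 : 0 ≤ K := by
    obtain ⟨x, hx⟩ := hΩconn.nonempty
    linarith [(abs_nonneg _).trans (hAx x hx), (abs_nonneg _).trans (hBx x hx)]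
  have hu₀c : ContinuousOn (fun q : ℝ × EuclideanSpace ℝ (Fin n) => u₀ q.2)
      (Icc 0 T ×ˢ closure Ω) :=
    (hu₀.continuousOn.mono hUΩ).comp continuousOn_snd fun q hq => hq.2
  have hupper : ∀ S < T, ∀ t ∈ Icc 0 S, ∀ x ∈ closure Ω, u t x - (u₀ x + K * t) ≤ 0 := by
    intro S hS
    refine parabolic_max_principle hΩo hcpt ?_ ?_ ?_ ?_
    · exact (hu.cont.sub (hu₀c.add (continuous_const.mul continuous_fst).continuousOn)).mono
        (prod_mono_left (Icc_subset_Icc_right hS.le))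
    · intro x hx
      simp [hu.init x hx]
    · intro t ht x hx
      rw [hu.bdry t ⟨ht.1, ht.2.trans_lt hS⟩ x hx, hu₀ψ x hx]
      linarith [mul_nonneg hK0 ht.1.le]
    · intro t ht x hx hpos hmax
      have ht' : t ∈ Ioo 0 T := ⟨ht.1, ht.2.trans_lt hS⟩
      have hmax' : IsLocalMax (fun y => u t y - u₀ y) x := by
        filter_upwards [hmax] with y hy
        linarith
      refine ⟨deriv (fun s => u s x) t - K * 1, ?_, (hu.diff_t t ht' x hx).hasDerivAt.sub
        (((hasDerivAt_id t).const_mul K).const_add (u₀ x))⟩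
      have hflux := hmax'.sum_pd_flux_le (hu.smooth_x t ht' x hx) (hu₀x x hx) hε0
        (hpd x hx) (hp1' x hx)
      have hF' := hFmono x (subset_closure hx) (u t x) (u₀ x) (gradv u₀ x)
        (by linarith [mul_nonneg hK0 ht.1.le])
      rw [hu.eqn t ht' x hx, gradv_congr fun i =>
        (hmax'.pd_sub (hu.smooth_x t ht' x hx) (hu₀x x hx) i).1]
      linarith [(abs_le.mp (hAx x hx)).2, (abs_le.mp (hBx x hx)).2]
  have hlower : ∀ S < T, ∀ t ∈ Icc 0 S, ∀ x ∈ closure Ω, (u₀ x - K * t) - u t x ≤ 0 := by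
    intro S hS
    refine parabolic_max_principle hΩo hcpt ?_ ?_ ?_ ?_
    · exact ((hu₀c.sub (continuous_const.mul continuous_fst).continuousOn).sub hu.cont).mono
        (prod_mono_left (Icc_subset_Icc_right hS.le))
    · intro x hx
      simp [hu.init x hx]
    · intro t ht x hx
      rw [hu.bdry t ⟨ht.1, ht.2.trans_lt hS⟩ x hx, hu₀ψ x hx]
      linarith [mul_nonneg hK0 ht.1.le]
    · intro t ht x hx hpos hmax
      have ht' : t ∈ Ioo 0 T := ⟨ht.1, ht.2.trans_lt hS⟩
      have hmax' : IsLocalMax (fun y => u₀ y - u t y) x := by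
        filter_upwards [hmax] with y hy
        linarith
      refine ⟨-(K * 1) - deriv (fun s => u s x) t, ?_,
        (((hasDerivAt_id t).const_mul K).const_sub (u₀ x)).sub
          (hu.diff_t t ht' x hx).hasDerivAt⟩
      have hflux := hmax'.sum_pd_flux_le (hu₀x x hx) (hu.smooth_x t ht' x hx) hε0
        (hpd x hx) (hp1' x hx)
      have hF' := hFmono x (subset_closure hx) (u₀ x) (u t x) (gradv u₀ x)
        (by linarith [mul_nonneg hK0 ht.1.le])
      rw [hu.eqn t ht' x hx, ← gradv_congr fun i =>
        (hmax'.pd_sub (hu₀x x hx) (hu.smooth_x t ht' x hx) i).1]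
      linarith [(abs_le.mp (hAx x hx)).1, (abs_le.mp (hBx x hx)).1]
  have hbdry : ∀ t ∈ Ico 0 T, ∀ x ∈ frontier Ω, u t x = ψ x := by
    intro t ht x hx
    rcases ht.1.eq_or_lt with rfl | h
    · rw [hu.init x (frontier_subset_closure hx), hu₀ψ x hx]
    · exact hu.bdry t ⟨h, ht.2⟩ x hx
  -- The difference of two time shifts of `u` takes its maximum on the parabolic boundary.
  have hcomp : ∀ a b S : ℝ, 0 ≤ a → 0 ≤ b → S + a < T → S + b < T → ∀ C : ℝ, 0 ≤ C →
      (∀ x ∈ closure Ω, u a x - u b x ≤ C) →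
      ∀ t ∈ Icc 0 S, ∀ x ∈ closure Ω, u (t + a) x - u (t + b) x - C ≤ 0 := by
    intro a b S ha hb hSa hSb C hC hinit
    have hshift : ∀ c : ℝ, 0 ≤ c → S + c < T → ContinuousOn
        (fun q : ℝ × EuclideanSpace ℝ (Fin n) => u (q.1 + c) q.2) (Icc 0 S ×ˢ closure Ω) := by
      intro c hc hSc
      refine hu.cont.comp (f := fun q : ℝ × EuclideanSpace ℝ (Fin n) => (q.1 + c, q.2))
        (by fun_prop) fun q hq => ⟨⟨?_, ?_⟩, hq.2⟩
      · linarith [hq.1.1]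
      · linarith [hq.1.2]
    refine parabolic_max_principle hΩo hcpt
      (((hshift a ha hSa).sub (hshift b hb hSb)).sub continuousOn_const) ?_ ?_ ?_
    · intro x hx
      simpa using hinit x hx
    · intro t ht x hx
      rw [hbdry (t + a) ⟨by linarith [ht.1], by linarith [ht.2]⟩ x hx,
        hbdry (t + b) ⟨by linarith [ht.1], by linarith [ht.2]⟩ x hx]
      linarith
    · intro t ht x hx hpos hmax
      have hta : t + a ∈ Ioo 0 T := ⟨by linarith [ht.1], by linarith [ht.2]⟩
      have htb : t + b ∈ Ioo 0 T := ⟨by linarith [ht.1], by linarith [ht.2]⟩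
      have hmax' : IsLocalMax (fun y => u (t + a) y - u (t + b) y) x := by
        filter_upwards [hmax] with y hy
        linarith
      refine ⟨deriv (fun s => u s x) (t + a) - deriv (fun s => u s x) (t + b), ?_,
        (((hu.diff_t _ hta x hx).hasDerivAt.comp_add_const t a).sub
          ((hu.diff_t _ htb x hx).hasDerivAt.comp_add_const t b)).sub_const C⟩
      have hflux := hmax'.sum_pd_flux_le (hu.smooth_x _ hta x hx) (hu.smooth_x _ htb x hx) hε0
        (hpd x hx) (hp1' x hx)
      have hF' := hFmono x (subset_closure hx) (u (t + a) x) (u (t + b) x)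
        (gradv (u (t + b)) x) (by linarith)
      rw [hu.eqn _ hta x hx, hu.eqn _ htb x hx, gradv_congr fun i =>
        (hmax'.pd_sub (hu.smooth_x _ hta x hx) (hu.smooth_x _ htb x hx) i).1]
      linarith
  have hlip : ∀ x ∈ Ω, ∀ s t, 0 < s → s ≤ t → t < T → |u t x - u s x| ≤ K * (t - s) := by
    intro x hx s t hs hst htT
    have hcl := subset_closure hx
    have hC : 0 ≤ K * (t - s) := mul_nonneg hK0 (by linarith)
    have hmem : t - s ∈ Icc 0 (t - s) := ⟨by linarith, le_rfl⟩
    have h1 := hcomp (t - s) 0 s (by linarith) le_rfl (by linarith) (by linarith) _ hC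
      (fun y hy => by
        rw [hu.init y hy]; linarith [hupper (t - s) (by linarith) _ hmem y hy])
      s ⟨hs.le, le_rfl⟩ x hcl
    have h2 := hcomp 0 (t - s) s le_rfl (by linarith) (by linarith) (by linarith) _ hC
      (fun y hy => by
        rw [hu.init y hy]; linarith [hlower (t - s) (by linarith) _ hmem y hy])
      s ⟨hs.le, le_rfl⟩ x hcl
    rw [add_sub_cancel, add_zero] at h1 h2
    exact abs_le.mpr ⟨by linarith, by linarith⟩
  intro t ht x hx
  refine (hu.diff_t t ht x hx).hasDerivAt.le_of_lip' hK0 ?_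
  filter_upwards [isOpen_Ioo.mem_nhds ht] with s hs
  rw [Real.norm_eq_abs, Real.norm_eq_abs]
  rcases le_total s t with h | h
  · rw [abs_sub_comm (u s x), abs_sub_comm s, abs_of_nonneg (sub_nonneg.mpr h)]
    exact hlip x hx s t hs.1 h ht.2
  · rw [abs_of_nonneg (sub_nonneg.mpr h)]
    exact hlip x hx t s ht.1 h hs.2
end
end

section
/- Let u_ε be a classical solution of the regularized isotropic problem with ε ∈ (0,ε₀], satisfying |u_ε| ≤ M on Q̄_T, and suppose F satisfies the monotonicity condition F(x,u,z) ≤ F(x,v,z) whenever u ≥ v. Then for every ε ∈ (0,ε₀] and all (t,x) ∈ Q̄_T one has |u_ε(t,x) − u₀(x)| ≤ K₁ t, where K₁ is the constant defined in the context (assumed finite). -/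
open Set Filter MeasureTheory Metric

noncomputable section

/-- Classical solution of the regularized isotropic problem
`u_t = div((|∇u|² + ε)^{p(x)/2} ∇u) + F(x, u, ∇u)` in `Q_T = (0,T) × Ω`,
with `u = ψ` on `∂Ω × (0,T)` and `u(0,·) = u₀` in `Ω`. -/
structure IsClassicalSolIso {n : ℕ} (Ω : Set (EuclideanSpace ℝ (Fin n))) (T : ℝ)
    (p : EuclideanSpace ℝ (Fin n) → ℝ)
    (F : EuclideanSpace ℝ (Fin n) → ℝ → EuclideanSpace ℝ (Fin n) → ℝ)
    (ψ u₀ : EuclideanSpace ℝ (Fin n) → ℝ) (ε : ℝ)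
    (u : ℝ → EuclideanSpace ℝ (Fin n) → ℝ) : Prop where
  cont : ContinuousOn (fun q : ℝ × EuclideanSpace ℝ (Fin n) => u q.1 q.2)
      (Icc 0 T ×ˢ closure Ω)
  diff_t : ∀ t ∈ Ioo 0 T, ∀ x ∈ Ω, DifferentiableAt ℝ (fun s => u s x) t
  smooth_x : ∀ t ∈ Ioo 0 T, ∀ x ∈ Ω, ContDiffAt ℝ 2 (u t) x
  cont_ut : ContinuousOn
      (fun q : ℝ × EuclideanSpace ℝ (Fin n) => deriv (fun s => u s q.2) q.1) (Ioo 0 T ×ˢ Ω)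
  cont_ux : ∀ i, ContinuousOn
      (fun q : ℝ × EuclideanSpace ℝ (Fin n) => pd (u q.1) i q.2) (Ioo 0 T ×ˢ Ω)
  cont_uxx : ∀ i j, ContinuousOn
      (fun q : ℝ × EuclideanSpace ℝ (Fin n) => pd (fun y => pd (u q.1) j y) i q.2)
      (Ioo 0 T ×ˢ Ω)
  eqn : ∀ t ∈ Ioo 0 T, ∀ x ∈ Ω,
      deriv (fun s => u s x) t =
        (∑ i, pd (fun y => (‖gradv (u t) y‖ ^ 2 + ε) ^ (p y / 2) * pd (u t) i y) i x)
          + F x (u t x) (gradv (u t) x)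
  bdry : ∀ t ∈ Ioo 0 T, ∀ x ∈ frontier Ω, u t x = ψ x
  init : ∀ x ∈ closure Ω, u 0 x = u₀ x

/-- Second-order necessary condition for an interior local maximum. -/
lemma IsLocalMax.fderiv_fderiv_nonpos {E : Type*} [NormedAddCommGroup E] [NormedSpace ℝ E]
    {w : E → ℝ} {x : E} (hw : ContDiffAt ℝ 2 w x) (hmax : IsLocalMax w x) (v : E) :
    fderiv ℝ (fderiv ℝ w) x v v ≤ 0 := by
  by_contra! hpos
  have hline : ∀ s : ℝ, HasDerivAt (fun s : ℝ => x + s • v) v s := fun s => by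
    simpa using ((hasDerivAt_id s).smul_const v).const_add x
  have hx0 : x + (0 : ℝ) • v = x := by simp
  have htend : Tendsto (fun s : ℝ => x + s • v) (nhds 0) (nhds x) := by
    simpa using (hline 0).continuousAt.tendsto
  have hd1 : deriv (fun s : ℝ => w (x + s • v)) =ᶠ[nhds 0]
      fun s => fderiv ℝ w (x + s • v) v := by
    filter_upwards [htend.eventually (hw.eventually (by simp))] with s hs
    exact ((hs.differentiableAt (by simp)).hasFDerivAt.comp_hasDerivAt s (hline s)).deriv
  have hD : HasFDerivAt (fderiv ℝ w) (fderiv ℝ (fderiv ℝ w) x) (x + (0 : ℝ) • v) := by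
    rw [hx0]
    exact ((hw.fderiv_right (m := 1) (by norm_num)).differentiableAt (by simp)).hasFDerivAt
  have hd2 : deriv (deriv (fun s : ℝ => w (x + s • v))) 0 = fderiv ℝ (fderiv ℝ w) x v v := by
    have hcomp : HasDerivAt (fun s : ℝ => fderiv ℝ w (x + s • v)) (fderiv ℝ (fderiv ℝ w) x v) 0 :=
      HasFDerivAt.comp_hasDerivAt (f := fun s : ℝ => x + s • v) 0 hD (hline 0)
    have happ := hcomp.clm_apply (hasDerivAt_const (0 : ℝ) v)
    rw [hd1.deriv_eq, happ.deriv]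
    simp
  have hmax0 : IsLocalMax (fun s : ℝ => w (x + s • v)) 0 := by
    filter_upwards [htend.eventually hmax] with s hs
    simpa using hs
  have hcont : ContinuousAt (fun s : ℝ => w (x + s • v)) 0 :=
    ContinuousAt.comp (by rw [hx0]; exact hw.continuousAt) (hline 0).continuousAt
  have hmin := isLocalMin_of_deriv_deriv_pos (hd2 ▸ hpos) hmax0.deriv_eq_zero hcont
  have hconst : (fun s : ℝ => w (x + s • v)) =ᶠ[nhds 0] fun _ => w (x + (0 : ℝ) • v) := by
    filter_upwards [hmin, hmax0] with s h1 h2 using le_antisymm h2 h1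
  have hzero : deriv (deriv (fun s : ℝ => w (x + s • v))) 0 = 0 := by
    rw [hconst.deriv.deriv_eq]; simp
  rw [← hd2, hzero] at hpos
  exact lt_irrefl _ hpos

lemma sum_smul_single {n : ℕ} (b : EuclideanSpace ℝ (Fin n)) :
    ∑ i, b i • EuclideanSpace.single i (1 : ℝ) = b := by
  ext j
  simp [Pi.single_apply]

lemma sum_mul_apply_single {n : ℕ} (L : EuclideanSpace ℝ (Fin n) →L[ℝ] ℝ)
    (b : EuclideanSpace ℝ (Fin n)) :
    ∑ i, b i * L (EuclideanSpace.single i 1) = L b := by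
  conv_rhs => rw [← sum_smul_single b]
  rw [map_sum]
  simp

lemma gradv_apply {n : ℕ} (f : EuclideanSpace ℝ (Fin n) → ℝ) (x : EuclideanSpace ℝ (Fin n))
    (i : Fin n) : gradv f x i = pd f i x := rfl

/-- A nonpositive bilinear form is bounded by its trace: `|b|² tr H ≤ H(b, b)`. -/
lemma norm_sq_mul_trace_le {n : ℕ}
    (H : EuclideanSpace ℝ (Fin n) →L[ℝ] EuclideanSpace ℝ (Fin n) →L[ℝ] ℝ)
    (hH : ∀ v, H v v ≤ 0) (b : EuclideanSpace ℝ (Fin n)) :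
    ‖b‖ ^ 2 * ∑ i, H (EuclideanSpace.single i 1) (EuclideanSpace.single i 1) ≤ H b b := by
  rcases eq_or_ne b 0 with rfl | hb
  · simp
  set s := ‖b‖ ^ 2 with hs
  have hspos : 0 < s := by positivity
  have hsum : ∑ i, b i ^ 2 = s := (EuclideanSpace.real_norm_sq_eq b).symm
  have hleft : ∑ i, b i * H (EuclideanSpace.single i 1) b = H b b := sum_mul_apply_single (H.flip b) b
  have hright : ∑ i, b i * H b (EuclideanSpace.single i 1) = H b b := sum_mul_apply_single (H b) b
  have hexp : ∑ i, H (s • EuclideanSpace.single i 1 - b i • b)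
      (s • EuclideanSpace.single i 1 - b i • b)
      = s * (s * ∑ i, H (EuclideanSpace.single i 1) (EuclideanSpace.single i 1) - H b b) := by
    calc _ = ∑ i, (s ^ 2 * H (EuclideanSpace.single i 1) (EuclideanSpace.single i 1)
          - s * (b i * H (EuclideanSpace.single i 1) b)
          - s * (b i * H b (EuclideanSpace.single i 1)) + b i ^ 2 * H b b) := by
            refine Finset.sum_congr rfl fun i _ => ?_
            simp only [map_sub, map_smul, _root_.sub_apply,
              _root_.smul_apply, smul_eq_mul]
            ring
      _ = _ := by
            rw [Finset.sum_add_distrib, Finset.sum_sub_distrib, Finset.sum_sub_distrib,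
              ← Finset.mul_sum, ← Finset.mul_sum, ← Finset.mul_sum, ← Finset.sum_mul,
              hleft, hright, hsum]
            ring
  have hle := Finset.sum_nonpos (s := Finset.univ) fun i (_ : i ∈ Finset.univ) =>
    hH (s • EuclideanSpace.single i 1 - b i • b)
  rw [hexp] at hle
  nlinarith

/-- The divergence-form operator in nondivergence form. -/
lemma div_flux_eq {n : ℕ} {f p : EuclideanSpace ℝ (Fin n) → ℝ} {x : EuclideanSpace ℝ (Fin n)}
    (hf : ContDiffAt ℝ 2 f x) (hp : DifferentiableAt ℝ p x) {ε : ℝ} (hε : 0 < ε) :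
    ∑ i, pd (fun y => (‖gradv f y‖ ^ 2 + ε) ^ (p y / 2) * pd f i y) i x
      = (‖gradv f x‖ ^ 2 + ε) ^ (p x / 2)
          * ∑ i, fderiv ℝ (fderiv ℝ f) x (EuclideanSpace.single i 1) (EuclideanSpace.single i 1)
        + p x * (‖gradv f x‖ ^ 2 + ε) ^ (p x / 2 - 1)
          * fderiv ℝ (fderiv ℝ f) x (gradv f x) (gradv f x)
        + (‖gradv f x‖ ^ 2 + ε) ^ (p x / 2) * Real.log (‖gradv f x‖ ^ 2 + ε)
          * fderiv ℝ (fun y => p y / 2) x (gradv f x) := by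
  set D := fderiv ℝ (fderiv ℝ f) x
  set b := gradv f x with hb
  have hD : HasFDerivAt (fderiv ℝ f) D x :=
    ((hf.fderiv_right (m := 1) (by norm_num)).differentiableAt (by simp)).hasFDerivAt
  have hpd : ∀ i, HasFDerivAt (pd f i) (D.flip (EuclideanSpace.single i 1)) x := fun i => by
    refine (hD.clm_apply (hasFDerivAt_const (EuclideanSpace.single i (1 : ℝ)) x)).congr_fderiv ?_
    ext v
    simp
  have hS : HasFDerivAt (fun y => ‖gradv f y‖ ^ 2 + ε) ((2 : ℝ) • D.flip b) x := by
    have heq : (fun y => ‖gradv f y‖ ^ 2 + ε) = fun y => ∑ i, pd f i y ^ 2 + ε := by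
      funext y
      rw [EuclideanSpace.real_norm_sq_eq]
      rfl
    rw [heq]
    refine ((HasFDerivAt.fun_sum fun i (_ : i ∈ Finset.univ) => (hpd i).pow 2).add_const
      ε).congr_fderiv ?_
    ext v
    have hv : ∑ i, pd f i x * D v (EuclideanSpace.single i 1) = D v b :=
      sum_mul_apply_single (D v) b
    simp [← hv, Finset.mul_sum, mul_assoc]
  have hSpos : 0 < ‖gradv f x‖ ^ 2 + ε := by positivity
  have hp2 : HasFDerivAt (fun y => p y / 2) (fderiv ℝ (fun y => p y / 2) x) x :=
    (hp.fun_mul (differentiableAt_const (2⁻¹ : ℝ))).hasFDerivAt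
  have hQ := hS.rpow hp2 hSpos
  rw [← hb] at hQ
  have hterm : ∀ i, pd (fun y => (‖gradv f y‖ ^ 2 + ε) ^ (p y / 2) * pd f i y) i x
      = (‖b‖ ^ 2 + ε) ^ (p x / 2) * D (EuclideanSpace.single i 1) (EuclideanSpace.single i 1)
        + p x * (‖b‖ ^ 2 + ε) ^ (p x / 2 - 1) * (b i * D (EuclideanSpace.single i 1) b)
        + (‖b‖ ^ 2 + ε) ^ (p x / 2) * Real.log (‖b‖ ^ 2 + ε)
          * (b i * fderiv ℝ (fun y => p y / 2) x (EuclideanSpace.single i 1)) := fun i => by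
    rw [pd, (hQ.fun_mul (hpd i)).fderiv, ← gradv_apply f x i, ← hb]
    simp
    ring
  have hleft : ∑ i, b i * D (EuclideanSpace.single i 1) b = D b b := sum_mul_apply_single (D.flip b) b
  have hlog : ∑ i, b i * fderiv ℝ (fun y => p y / 2) x (EuclideanSpace.single i 1)
      = fderiv ℝ (fun y => p y / 2) x b :=
    sum_mul_apply_single _ b
  rw [Finset.sum_congr rfl fun i _ => hterm i, Finset.sum_add_distrib, Finset.sum_add_distrib,
    ← Finset.mul_sum, ← Finset.mul_sum, ← Finset.mul_sum, hleft, hlog]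

lemma gradv_eq_of_isLocalMax_sub {n : ℕ} {f g : EuclideanSpace ℝ (Fin n) → ℝ}
    {x : EuclideanSpace ℝ (Fin n)} (hf : DifferentiableAt ℝ f x) (hg : DifferentiableAt ℝ g x)
    (hmax : IsLocalMax (fun y => f y - g y) x) : gradv f x = gradv g x := by
  have h := hmax.fderiv_eq_zero
  rw [fderiv_fun_sub hf hg, sub_eq_zero] at h
  simp only [gradv, pd, h]

/-- Ellipticity: the operator is ordered at a local maximum of the difference. -/
lemma div_flux_le_of_isLocalMax_sub {n : ℕ} {f g p : EuclideanSpace ℝ (Fin n) → ℝ}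
    {x : EuclideanSpace ℝ (Fin n)} (hf : ContDiffAt ℝ 2 f x) (hg : ContDiffAt ℝ 2 g x)
    (hp : DifferentiableAt ℝ p x) (hp1 : -1 < p x) {ε : ℝ} (hε : 0 < ε)
    (hmax : IsLocalMax (fun y => f y - g y) x) :
    ∑ i, pd (fun y => (‖gradv f y‖ ^ 2 + ε) ^ (p y / 2) * pd f i y) i x
      ≤ ∑ i, pd (fun y => (‖gradv g y‖ ^ 2 + ε) ^ (p y / 2) * pd g i y) i x := by
  have hgrad := gradv_eq_of_isLocalMax_sub (hf.differentiableAt (by simp))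
    (hg.differentiableAt (by simp)) hmax
  rw [div_flux_eq hf hp hε, div_flux_eq hg hp hε, hgrad]
  set b := gradv g x
  set H := fderiv ℝ (fderiv ℝ fun y => f y - g y) x with hHdef
  have hH : ∀ v, H v v ≤ 0 := hmax.fderiv_fderiv_nonpos (hf.sub hg)
  have hsub : H = fderiv ℝ (fderiv ℝ f) x - fderiv ℝ (fderiv ℝ g) x := by
    have heq : fderiv ℝ (fun y => f y - g y) =ᶠ[nhds x] fun y => fderiv ℝ f y - fderiv ℝ g y := by
      filter_upwards [hf.eventually (by simp), hg.eventually (by simp)] with y h1 h2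
      exact fderiv_fun_sub (h1.differentiableAt (by simp)) (h2.differentiableAt (by simp))
    rw [hHdef, heq.fderiv_eq]
    exact fderiv_fun_sub ((hf.fderiv_right (m := 1) (by norm_num)).differentiableAt (by simp))
      ((hg.fderiv_right (m := 1) (by norm_num)).differentiableAt (by simp))
  have htrace := norm_sq_mul_trace_le H hH b
  have htr : ∑ i, H (EuclideanSpace.single i 1) (EuclideanSpace.single i 1) ≤ 0 :=
    Finset.sum_nonpos fun i _ => hH _
  have hbb := hH b
  have hSpos : 0 < ‖b‖ ^ 2 + ε := by positivity
  have hpow : (‖b‖ ^ 2 + ε) ^ (p x / 2)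
      = (‖b‖ ^ 2 + ε) ^ (p x / 2 - 1) * (‖b‖ ^ 2 + ε) := by
    rw [Real.rpow_sub_one hSpos.ne', div_mul_cancel₀ _ hSpos.ne']
  have hc : 0 < (‖b‖ ^ 2 + ε) ^ (p x / 2 - 1) := Real.rpow_pos_of_pos hSpos _
  have hkey : (‖b‖ ^ 2 + ε) * ∑ i, H (EuclideanSpace.single i 1) (EuclideanSpace.single i 1)
      + p x * H b b ≤ 0 := by nlinarith
  have hmul := mul_nonpos_of_nonneg_of_nonpos hc.le hkey
  simp only [hsub, _root_.sub_apply, Finset.sum_sub_distrib] at hmul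
  rw [hpow]
  linarith

/-- A function on a parabolic cylinder, nonpositive on the parabolic boundary and with time
derivative at most `K` at interior spatial local maxima, is at most `K * t`. -/
lemma le_mul_of_deriv_le_at_isLocalMax {E : Type*} [NormedAddCommGroup E] [NormedSpace ℝ E]
    [ProperSpace E] {Ω : Set E} (hΩo : IsOpen Ω) (hΩbd : Bornology.IsBounded Ω)
    {T K : ℝ} (hT : 0 < T) (hK : 0 ≤ K) {w : ℝ → E → ℝ}
    (hcont : ContinuousOn (fun q : ℝ × E => w q.1 q.2) (Icc 0 T ×ˢ closure Ω))
    (hdiff : ∀ t ∈ Ioo 0 T, ∀ x ∈ Ω, DifferentiableAt ℝ (fun s => w s x) t)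
    (hinit : ∀ x ∈ closure Ω, w 0 x ≤ 0)
    (hbdry : ∀ t ∈ Ioo 0 T, ∀ x ∈ frontier Ω, w t x ≤ 0)
    (hmax : ∀ t ∈ Ioo 0 T, ∀ x ∈ Ω, IsLocalMax (w t) x → deriv (fun s => w s x) t ≤ K) :
    ∀ t ∈ Icc 0 T, ∀ x ∈ closure Ω, w t x ≤ K * t := by
  have hinner : ∀ t ∈ Ioo 0 T, ∀ x ∈ closure Ω, w t x ≤ K * t := by
    intro t ht x hx
    refine le_of_forall_pos_le_add fun η hη => ?_
    set δ := η / t with hδ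
    have hδpos : 0 < δ := div_pos hη ht.1
    have hcpt : IsCompact (Icc 0 t ×ˢ closure Ω) := isCompact_Icc.prod hΩbd.isCompact_closure
    obtain ⟨⟨t₀, x₀⟩, ⟨ht₀, hx₀⟩, hq⟩ := hcpt.exists_isMaxOn
      (f := fun q : ℝ × E => w q.1 q.2 - (K + δ) * q.1) ⟨(t, x), ⟨⟨ht.1.le, le_rfl⟩, hx⟩⟩
      ((hcont.mono (prod_mono (Icc_subset_Icc_right ht.2.le) subset_rfl)).sub (by fun_prop))
    have hle : w t₀ x₀ - (K + δ) * t₀ ≤ 0 := by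
      by_contra! hpos
      simp only at ht₀ hx₀
      have ht₀pos : 0 < t₀ := by
        refine lt_of_le_of_ne ht₀.1 fun h => ?_
        subst h
        linarith [hinit x₀ hx₀]
      have ht₀T : t₀ ∈ Ioo 0 T := ⟨ht₀pos, ht₀.2.trans_lt ht.2⟩
      have hx₀Ω : x₀ ∈ Ω := by
        by_contra hnot
        have := hbdry t₀ ht₀T x₀ ⟨hx₀, by rwa [hΩo.interior_eq]⟩
        nlinarith [mul_pos (add_pos_of_nonneg_of_pos hK hδpos) ht₀pos]
      have hloc : IsLocalMax (w t₀) x₀ := by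
        filter_upwards [hΩo.mem_nhds hx₀Ω] with y hy
        have := hq (show (t₀, y) ∈ Icc 0 t ×ˢ closure Ω from ⟨ht₀, subset_closure hy⟩)
        simp only [mem_ofPred_eq] at this
        linarith
      have hderiv := hmax t₀ ht₀T x₀ hx₀Ω hloc
      have hd : HasDerivAt (fun s => w s x₀ - (K + δ) * s)
          (deriv (fun s => w s x₀) t₀ - (K + δ)) t₀ := by
        simpa using (hdiff t₀ ht₀T x₀ hx₀Ω).hasDerivAt.fun_sub
          ((hasDerivAt_id' t₀).const_mul (K + δ))
      have htime : IsMaxOn (fun s => w s x₀ - (K + δ) * s) (Icc 0 t) t₀ := fun s hs =>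
        hq (show (s, x₀) ∈ Icc 0 t ×ˢ closure Ω from ⟨hs, hx₀⟩)
      have hcone : (0 : ℝ) - t₀ ∈ posTangentConeAt (Icc 0 t) t₀ :=
        sub_mem_posTangentConeAt_of_segment_subset
          ((convex_Icc 0 t).segment_subset ht₀ ⟨le_rfl, ht.1.le⟩)
      have := htime.localize.hasFDerivWithinAt_nonpos hd.hasFDerivAt.hasFDerivWithinAt hcone
      simp at this
      nlinarith
    have hfin := (hq (show (t, x) ∈ Icc 0 t ×ˢ closure Ω from
      ⟨⟨ht.1.le, le_rfl⟩, hx⟩)).trans hle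
    have hδt : δ * t = η := div_mul_cancel₀ _ ht.1.ne'
    simp only at hfin
    linarith
  intro t ht x hx
  have hslice : ContinuousOn (fun s => w s x) (Icc 0 T) :=
    hcont.comp (f := fun s => (s, x)) (by fun_prop) fun s hs => ⟨hs, hx⟩
  rw [← closure_Ioo hT.ne] at ht hslice
  exact le_on_closure (f := fun s => w s x) (g := fun s => K * s)
    (fun s hs => hinner s hs x hx) hslice (by fun_prop) ht

theorem stmt6
    (n : ℕ) (hn : 0 < n)
    (Ω : Set (EuclideanSpace ℝ (Fin n)))
    (hΩo : IsOpen Ω) (hΩconn : IsConnected Ω)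
    (hΩbd : Bornology.IsBounded Ω) (hΩsph : ExteriorSphereCond Ω)
    (T : ℝ) (hT : 0 < T)
    (γ : ℝ) (hγ : γ ∈ Ioo (0:ℝ) 1)
    (p : EuclideanSpace ℝ (Fin n) → ℝ)
    (hp : C1HolderOn γ (closure Ω) p)
    (hp1 : ∀ x ∈ closure Ω, -1 < p x)
    (ε₀ : ℝ) (hε₀ : 0 < ε₀)
    (F : EuclideanSpace ℝ (Fin n) → ℝ → EuclideanSpace ℝ (Fin n) → ℝ)
    (hF : ContinuousOn
      (fun q : EuclideanSpace ℝ (Fin n) × ℝ × EuclideanSpace ℝ (Fin n) => F q.1 q.2.1 q.2.2)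
      (closure Ω ×ˢ (univ : Set (ℝ × EuclideanSpace ℝ (Fin n)))))
    (hFmono : ∀ x ∈ closure Ω, ∀ v w : ℝ, ∀ z : EuclideanSpace ℝ (Fin n),
      w ≤ v → F x v z ≤ F x w z)
    (ψ u₀ : EuclideanSpace ℝ (Fin n) → ℝ)
    (U : Set (EuclideanSpace ℝ (Fin n))) (hU : IsOpen U) (hUΩ : closure Ω ⊆ U)
    (hu₀ : ContDiffOn ℝ 2 u₀ U)
    (hu₀ψ : ∀ x ∈ frontier Ω, u₀ x = ψ x)
    (M : ℝ) (hM : 0 < M)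
    (ε : ℝ) (hε : ε ∈ Ioc (0:ℝ) ε₀)
    (u : ℝ → EuclideanSpace ℝ (Fin n) → ℝ)
    (hu : IsClassicalSolIso Ω T p F ψ u₀ ε u)
    (hub : ∀ t ∈ Icc 0 T, ∀ x ∈ closure Ω, |u t x| ≤ M)
    (A B K₁ : ℝ)
    (hA : IsLUB {a : ℝ | ∃ ε' ∈ Icc (0:ℝ) ε₀, ∃ x ∈ closure Ω,
      a = |∑ i, pd (fun y => (‖gradv u₀ y‖ ^ 2 + ε') ^ (p y / 2) * pd u₀ i y) i x|} A)
    (hB : IsLUB {a : ℝ | ∃ x ∈ closure Ω, ∃ v ∈ Icc (-M) M,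
      a = |F x v (gradv u₀ x)|} B)
    (hK₁ : K₁ = A + B)
    :
    ∀ t ∈ Icc 0 T, ∀ x ∈ closure Ω, |u t x - u₀ x| ≤ K₁ * t := by
  have hsub : Ω ⊆ closure Ω := subset_closure
  have hpΩ : ∀ x ∈ Ω, DifferentiableAt ℝ p x := fun x hx =>
    (hp.1.differentiableOn (by simp)).differentiableAt
      (mem_of_superset (hΩo.mem_nhds hx) hsub)
  have hu₀at : ∀ x ∈ closure Ω, ContDiffAt ℝ 2 u₀ x := fun x hx =>
    hu₀.contDiffAt (hU.mem_nhds (hUΩ hx))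
  have hu₀cont : ContinuousOn (fun q : ℝ × EuclideanSpace ℝ (Fin n) => u₀ q.2)
      (Icc 0 T ×ˢ closure Ω) :=
    (hu₀.continuousOn.mono hUΩ).comp continuousOn_snd fun q hq => hq.2
  have hAle : ∀ x ∈ closure Ω,
      |∑ i, pd (fun y => (‖gradv u₀ y‖ ^ 2 + ε) ^ (p y / 2) * pd u₀ i y) i x| ≤ A :=
    fun x hx => hA.1 ⟨ε, ⟨hε.1.le, hε.2⟩, x, hx, rfl⟩
  have hBle : ∀ x ∈ closure Ω, ∀ v, |v| ≤ M → |F x v (gradv u₀ x)| ≤ B :=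
    fun x hx v hv => hB.1 ⟨x, hx, v, abs_le.1 hv, rfl⟩
  have hK : 0 ≤ K₁ := by
    obtain ⟨x, hx⟩ := hΩconn.nonempty
    rw [hK₁]
    exact add_nonneg ((abs_nonneg _).trans (hAle x (hsub hx)))
      ((abs_nonneg _).trans (hBle x (hsub hx) 0 (by simpa using hM.le)))
  have hupper := le_mul_of_deriv_le_at_isLocalMax (w := fun t x => u t x - u₀ x) hΩo hΩbd hT hK
    (hu.cont.sub hu₀cont) (fun t ht x hx => (hu.diff_t t ht x hx).sub_const _)
    (fun x hx => by simp [hu.init x hx])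
    (fun t ht x hx => by simp [hu.bdry t ht x hx, hu₀ψ x hx])
    (fun t ht x hx hmax => by
      have hut := hu.smooth_x t ht x hx
      have hux := hu₀at x (hsub hx)
      have hdiv := div_flux_le_of_isLocalMax_sub hut hux (hpΩ x hx) (hp1 x (hsub hx)) hε.1 hmax
      have hgrad := gradv_eq_of_isLocalMax_sub (hut.differentiableAt (by simp))
        (hux.differentiableAt (by simp)) hmax
      have hFB := hBle x (hsub hx) (u t x) (hub t ⟨ht.1.le, ht.2.le⟩ x (hsub hx))
      rw [deriv_sub_const, hu.eqn t ht x hx, hgrad]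
      linarith [(abs_le.1 (hAle x (hsub hx))).2, (abs_le.1 hFB).2])
  have hlower := le_mul_of_deriv_le_at_isLocalMax (w := fun t x => u₀ x - u t x) hΩo hΩbd hT hK
    (hu₀cont.sub hu.cont) (fun t ht x hx => (hu.diff_t t ht x hx).const_sub _)
    (fun x hx => by simp [hu.init x hx])
    (fun t ht x hx => by simp [hu.bdry t ht x hx, hu₀ψ x hx])
    (fun t ht x hx hmax => by
      have hut := hu.smooth_x t ht x hx
      have hux := hu₀at x (hsub hx)
      have hdiv := div_flux_le_of_isLocalMax_sub hux hut (hpΩ x hx) (hp1 x (hsub hx)) hε.1 hmax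
      have hgrad := gradv_eq_of_isLocalMax_sub (hux.differentiableAt (by simp))
        (hut.differentiableAt (by simp)) hmax
      have hFB := hBle x (hsub hx) (u t x) (hub t ⟨ht.1.le, ht.2.le⟩ x (hsub hx))
      rw [deriv_const_sub, hu.eqn t ht x hx, ← hgrad]
      linarith [(abs_le.1 (hAle x (hsub hx))).1, (abs_le.1 hFB).1])
  intro t ht x hx
  rw [abs_le]
  constructor
  · linarith [hlower t ht x hx]
  · exact hupper t ht x hx
end
end
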